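/- For the Mehler kernel: for every z ∈ [0,1) and x ∈ ℝ, ∑_{k=0}^{∞} z^k ψ_k(x)² = (1/√(π(1-z²))) · exp(-x² (1-z)/(1+z)), where ψ_k are the Hermite functions ψ_k(x) = (√π 2^k k!)^{-1/2} H_k(x) e^{-x²/2} and H_k is the k-th (physicists') Hermite polynomial. -/

import Mathlib

open Real

/-- The physicists' Hermite polynomial `H_k(x) = (-1)^k e^{x²} (d/dx)^k e^{-x²}`. -/
noncomputable def physHermite (k : ℕ) (x : ℝ) : ℝ :=
  (-1 : ℝ) ^ k * Real.exp (x ^ 2) * iteratedDeriv k (fun y => Real.exp (-y ^ 2)) x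

/-- The `k`-th Hermite function. -/
noncomputable def hermiteFun (k : ℕ) (x : ℝ) : ℝ :=
  (Real.sqrt (Real.sqrt π * 2 ^ k * Nat.factorial k))⁻¹ * physHermite k x *
    Real.exp (-x ^ 2 / 2)


lemma gauss_deriv (y : ℝ) :
    HasDerivAt (fun y : ℝ => Real.exp (-y ^ 2)) (Real.exp (-y ^ 2) * (-(2 * y))) y := by
  have h : HasDerivAt (fun y : ℝ => -y ^ 2) (-(2 * y)) y := by
    have h0 : HasDerivAt (fun y : ℝ => y ^ 2) (2 * y) y := by simpa using hasDerivAt_pow 2 y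
    exact h0.neg
  exact h.exp

lemma gauss_rec (n : ℕ) : ∀ y : ℝ,
    iteratedDeriv (n + 2) (fun y : ℝ => Real.exp (-y ^ 2)) y =
      -2 * y * iteratedDeriv (n + 1) (fun y : ℝ => Real.exp (-y ^ 2)) y
        - 2 * (n + 1) * iteratedDeriv n (fun y : ℝ => Real.exp (-y ^ 2)) y := by
  set g : ℝ → ℝ := fun y => Real.exp (-y ^ 2) with hg
  have hc : ContDiff ℝ ⊤ g := by rw [hg]; fun_prop
  have hd : ∀ (m : ℕ) (y : ℝ), HasDerivAt (iteratedDeriv m g) (iteratedDeriv (m + 1) g y) y := by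
    intro m y
    rw [iteratedDeriv_succ]
    have h : Differentiable ℝ (iteratedDeriv m g) :=
      hc.differentiable_iteratedDeriv m (WithTop.coe_lt_top _)
    exact (h y).hasDerivAt
  have h1 : ∀ y, iteratedDeriv 1 g y = -2 * y * g y := by
    intro y
    have h2 := gauss_deriv y
    rw [iteratedDeriv_one, hg, h2.deriv]
    ring
  induction n with
  | zero =>
    intro y
    have e : iteratedDeriv (0 + 1) g = fun y => -2 * y * iteratedDeriv 0 g y := by
      funext y; rw [iteratedDeriv_zero]; exact h1 y
    have h3 := hd (0 + 1) y
    nth_rewrite 1 [e] at h3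
    have h4 : HasDerivAt (fun y => -2 * y * iteratedDeriv 0 g y)
        (-2 * 1 * iteratedDeriv 0 g y + -2 * y * iteratedDeriv (0 + 1) g y) y :=
      ((hasDerivAt_id y).const_mul (-2)).mul (hd 0 y)
    have := h3.unique h4
    rw [show 0 + 2 = 0 + 1 + 1 from rfl, this]
    push_cast; ring
  | succ n ih =>
    intro y
    have e : iteratedDeriv (n + 2) g = fun y => -2 * y * iteratedDeriv (n + 1) g y
        - 2 * (n + 1) * iteratedDeriv n g y := by
      funext y; exact ih y
    have h3 := hd (n + 2) y
    nth_rewrite 1 [e] at h3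
    have h4 : HasDerivAt (fun y => -2 * y * iteratedDeriv (n + 1) g y
        - 2 * (n + 1) * iteratedDeriv n g y)
        (-2 * 1 * iteratedDeriv (n + 1) g y + -2 * y * iteratedDeriv (n + 1 + 1) g y
          - 2 * (n + 1) * iteratedDeriv (n + 1) g y) y :=
      (((hasDerivAt_id y).const_mul (-2)).mul (hd (n + 1) y)).sub
        ((hd n y).const_mul (2 * ((n : ℝ) + 1)))
    have := h3.unique h4
    rw [show n + 1 + 2 = n + 2 + 1 from rfl, this]
    push_cast; ring

lemma physHermite_zero (x : ℝ) : physHermite 0 x = 1 := by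
  simp [physHermite, ← Real.exp_add]

lemma physHermite_one (x : ℝ) : physHermite 1 x = 2 * x := by
  have h2 := gauss_deriv x
  have h3 : Real.exp (x ^ 2) * Real.exp (-x ^ 2) = 1 := by simp [← Real.exp_add]
  rw [physHermite, iteratedDeriv_one, h2.deriv]
  linear_combination (2 * x) * h3

lemma physHermite_rec (n : ℕ) (x : ℝ) :
    physHermite (n + 2) x = 2 * x * physHermite (n + 1) x - 2 * (n + 1) * physHermite n x := by
  unfold physHermite
  rw [gauss_rec]
  ring

/-- normalized squares -/
noncomputable def hsq (x : ℝ) (n : ℕ) : ℝ := physHermite n x ^ 2 / (2 ^ n * n.factorial)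

lemma hsq_nonneg (x : ℝ) (n : ℕ) : 0 ≤ hsq x n := by unfold hsq; positivity

lemma hsq_zero (x : ℝ) : hsq x 0 = 1 := by simp [hsq, physHermite_zero]

lemma hsq_one (x : ℝ) : hsq x 1 = 2 * x ^ 2 := by
  simp [hsq, physHermite_one]; ring

lemma hsq_two (x : ℝ) : hsq x 2 = (2 * x ^ 2 - 1) ^ 2 / 2 := by
  have := physHermite_rec 0 x
  simp [physHermite_one, physHermite_zero] at this
  simp [hsq, this]; ring

lemma hsq_rec (x : ℝ) (n : ℕ) : ((n : ℝ) + 3) * hsq x (n + 3) =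
    (2 * x ^ 2 - n - 2) * hsq x (n + 2) + (n + 2 - 2 * x ^ 2) * hsq x (n + 1)
      + (n + 1) * hsq x n := by
  have h2 := physHermite_rec n x
  have h3 := physHermite_rec (n + 1) x
  rw [show n + 1 + 2 = n + 3 from rfl, show n + 1 + 1 = n + 2 from rfl, h2] at h3
  have hf : (n.factorial : ℝ) ≠ 0 := by positivity
  have e1 : ((n + 1).factorial : ℝ) = (n + 1) * n.factorial := by
    rw [Nat.factorial_succ]; push_cast; ring
  have e2 : ((n + 2).factorial : ℝ) = (n + 2) * ((n + 1) * n.factorial) := by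
    rw [Nat.factorial_succ, Nat.factorial_succ]; push_cast; ring
  have e3 : ((n + 3).factorial : ℝ) = (n + 3) * ((n + 2) * ((n + 1) * n.factorial)) := by
    rw [Nat.factorial_succ, Nat.factorial_succ, Nat.factorial_succ]; push_cast; ring
  have p1 : (n : ℝ) + 1 ≠ 0 := by positivity
  have p2 : (n : ℝ) + 2 ≠ 0 := by positivity
  have p3 : (n : ℝ) + 3 ≠ 0 := by positivity
  unfold hsq
  rw [h3, h2, e1, e2, e3]
  push_cast
  generalize physHermite n x = p
  generalize physHermite (n + 1) x = q
  rw [pow_add, pow_add, pow_add]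
  field_simp
  ring

lemma hsq_bound (x δ : ℝ) (hδ : 0 < δ) (n : ℕ) (hn : (1 + 1 / δ) * (2 * x ^ 2) ≤ δ * (n + 2)) :
    hsq x (n + 2) ≤ δ * hsq x (n + 1) + (1 + δ) * hsq x n := by
  have h2 := physHermite_rec n x
  have hf : (0 : ℝ) < n.factorial := by positivity
  have e1 : ((n + 1).factorial : ℝ) = (n + 1) * n.factorial := by
    rw [Nat.factorial_succ]; push_cast; ring
  have e2 : ((n + 2).factorial : ℝ) = (n + 2) * ((n + 1) * n.factorial) := by
    rw [Nat.factorial_succ, Nat.factorial_succ]; push_cast; ring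
  have key : ((n : ℝ) + 2) * hsq x (n + 2) ≤
      (1 + 1 / δ) * (2 * x ^ 2) * hsq x (n + 1) + (1 + δ) * (n + 1) * hsq x n := by
    have : (1 + 1 / δ) * (2 * x ^ 2) * hsq x (n + 1) + (1 + δ) * (n + 1) * hsq x n
        - ((n : ℝ) + 2) * hsq x (n + 2) =
        (2 * x * physHermite (n + 1) x + δ * (2 * (n + 1) * physHermite n x)) ^ 2 /
          (δ * (4 * 2 ^ n * ((n + 1) * n.factorial))) := by
      unfold hsq
      rw [h2, e1, e2]
      generalize physHermite n x = p
      generalize physHermite (n + 1) x = q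
      rw [pow_add, pow_add]
      field_simp
      ring
    have h0 : 0 ≤ (2 * x * physHermite (n + 1) x + δ * (2 * (n + 1) * physHermite n x)) ^ 2 /
          (δ * (4 * 2 ^ n * ((n + 1) * n.factorial))) := by positivity
    linarith
  have a0 := hsq_nonneg x n
  have a1 := hsq_nonneg x (n + 1)
  have k1 := mul_le_mul_of_nonneg_right hn a1
  have k2 : (1 + δ) * ((n : ℝ) + 1) * hsq x n ≤ (1 + δ) * (n + 2) * hsq x n := by
    gcongr; norm_num
  have : ((n : ℝ) + 2) * hsq x (n + 2) ≤
      ((n : ℝ) + 2) * (δ * hsq x (n + 1) + (1 + δ) * hsq x n) := by linarith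
  exact le_of_mul_le_mul_left this (by positivity)

lemma hsq_summable (x r : ℝ) (h0 : 0 ≤ r) (h1 : r < 1) :
    Summable (fun n : ℕ => ((n : ℝ) + 1) * hsq x n * r ^ n) := by
  obtain ⟨δ, hδ, hδr⟩ : ∃ δ : ℝ, 0 < δ ∧ (1 + δ) * (1 + δ) * r < 1 := by
    refine ⟨(1 - r) / 4, by linarith, ?_⟩
    nlinarith [mul_nonneg h0 h0, mul_nonneg (mul_nonneg h0 h0) h0, mul_nonneg h0 (sub_pos.2 h1).le]
  obtain ⟨N, hN⟩ := exists_nat_gt (((1 + 1 / δ) * (2 * x ^ 2) + 1) / δ)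
  rw [div_lt_iff₀ hδ] at hN
  have hS : Summable (fun n : ℕ => ((n : ℝ) + 1) * (hsq x n + hsq x (n + 1)) * r ^ n) := by
    apply summable_of_ratio_norm_eventually_le hδr
    filter_upwards [Filter.eventually_ge_atTop N] with n hn
    have hn' : (N : ℝ) ≤ n := by exact_mod_cast hn
    have b0 := hsq_nonneg x n
    have b1 := hsq_nonneg x (n + 1)
    have b2 := hsq_nonneg x (n + 2)
    have hx : 0 ≤ (1 + 1 / δ) * (2 * x ^ 2) := by positivity
    have hdn : δ * N ≤ δ * n := by gcongr
    have hb := hsq_bound x δ hδ n (by nlinarith)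
    have hc : (n : ℝ) + 1 + 1 ≤ (1 + δ) * (n + 1) := by nlinarith
    rw [Real.norm_of_nonneg (by positivity), Real.norm_of_nonneg (by positivity)]
    have hE : hsq x (n + 1) + hsq x (n + 1 + 1) ≤ (1 + δ) * (hsq x n + hsq x (n + 1)) := by
      rw [show n + 1 + 1 = n + 2 from rfl]; linarith
    push_cast
    calc ((n : ℝ) + 1 + 1) * (hsq x (n + 1) + hsq x (n + 1 + 1)) * r ^ (n + 1)
        ≤ ((1 + δ) * (n + 1)) * ((1 + δ) * (hsq x n + hsq x (n + 1))) * r ^ (n + 1) := by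
          have : 0 ≤ hsq x (n + 1) + hsq x (n + 1 + 1) := add_nonneg b1 b2
          gcongr
      _ = _ := by ring
  refine hS.of_nonneg_of_le (fun n => ?_) (fun n => ?_)
  · have := hsq_nonneg x n
    positivity
  · have := hsq_nonneg x (n + 1)
    gcongr
    linarith

/-- the generating function -/
noncomputable def genF (x z : ℝ) : ℝ := ∑' n : ℕ, hsq x n * z ^ n

/-- its derivative -/
noncomputable def genD (x z : ℝ) : ℝ := ∑' n : ℕ, hsq x n * (n * z ^ (n - 1))

lemma sum_f (x z : ℝ) (hz : |z| < 1) : Summable (fun n : ℕ => hsq x n * z ^ n) := by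
  refine (hsq_summable x |z| (abs_nonneg z) hz).of_norm_bounded (fun n => ?_)
  have := hsq_nonneg x n
  rw [norm_mul, norm_pow, Real.norm_of_nonneg this, Real.norm_eq_abs]
  gcongr
  nlinarith [(Nat.cast_nonneg n : (0 : ℝ) ≤ n)]

lemma sum_e (x z : ℝ) (hz : |z| < 1) : Summable (fun n : ℕ => n * hsq x n * z ^ n) := by
  refine (hsq_summable x |z| (abs_nonneg z) hz).of_norm_bounded (fun n => ?_)
  have := hsq_nonneg x n
  rw [norm_mul, norm_pow, Real.norm_of_nonneg (by positivity), Real.norm_eq_abs]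
  gcongr
  linarith

lemma sum_dbound (x r : ℝ) (h0 : 0 < r) (hr : r < 1) :
    Summable (fun n : ℕ => hsq x n * (n * r ^ (n - 1))) := by
  have := (sum_e x r (by rwa [abs_of_pos h0])).mul_left r⁻¹
  refine this.congr (fun n => ?_)
  cases n with
  | zero => simp
  | succ n => simp [pow_succ]; field_simp

lemma sum_d (x z : ℝ) (hz : |z| < 1) :
    Summable (fun n : ℕ => hsq x n * (n * z ^ (n - 1))) := by
  obtain ⟨r, hr, hr1⟩ := exists_between hz
  have hr0 : 0 < r := (abs_nonneg z).trans_lt hr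
  refine (sum_dbound x r hr0 hr1).of_norm_bounded (fun n => ?_)
  have := hsq_nonneg x n
  rw [norm_mul, norm_mul, norm_pow, Real.norm_of_nonneg this, Real.norm_eq_abs z,
    Real.norm_of_nonneg (Nat.cast_nonneg n)]
  gcongr

lemma genF_deriv (x z : ℝ) (hz : |z| < 1) : HasDerivAt (genF x) (genD x z) z := by
  obtain ⟨r, hr, hr1⟩ := exists_between hz
  have hr0 : 0 < r := (abs_nonneg z).trans_lt hr
  refine hasDerivAt_tsum_of_isPreconnected (sum_dbound x r hr0 hr1) (t := Metric.ball 0 r)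
    Metric.isOpen_ball (convex_ball 0 r).isPreconnected (y₀ := 0)
    (g := fun n z => hsq x n * z ^ n) (g' := fun n z => hsq x n * (n * z ^ (n - 1))) ?_ ?_ ?_ ?_ ?_
  · intro n y _
    exact (hasDerivAt_pow n y).const_mul _
  · intro n y hy
    have := hsq_nonneg x n
    have hy' : |y| ≤ r := by simpa using (mem_ball_zero_iff.1 hy).le
    rw [norm_mul, norm_mul, norm_pow, Real.norm_of_nonneg this, Real.norm_eq_abs y,
      Real.norm_of_nonneg (Nat.cast_nonneg n)]
    gcongr
  · simpa using hr0
  · exact sum_f x 0 (by simp)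
  · simpa using hr

lemma gen_ode (x z : ℝ) (hz : |z| < 1) :
    (1 - z ^ 2) * (1 + z) * genD x z = (z * (1 + z) + 2 * x ^ 2 * (1 - z)) * genF x z := by
  have sf := sum_f x z hz
  have se := sum_e x z hz
  have sd := sum_d x z hz
  have hE : ∑' n : ℕ, n * hsq x n * z ^ n = z * genD x z := by
    rw [genD, ← tsum_mul_left]
    congr 1; funext n
    cases n with
    | zero => simp
    | succ n => simp [pow_succ]; ring
  have f1 := sf.sum_add_tsum_nat_add 1
  have f2 := sf.sum_add_tsum_nat_add 2
  have e1 := se.sum_add_tsum_nat_add 1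
  have e2 := se.sum_add_tsum_nat_add 2
  have d3 := sd.sum_add_tsum_nat_add 3
  have sf1 := (summable_nat_add_iff 1).2 sf
  have sf2 := (summable_nat_add_iff 2).2 sf
  have se1 := (summable_nat_add_iff 1).2 se
  have se2 := (summable_nat_add_iff 2).2 se
  have H := (((((sf2.hasSum.mul_left (2 * x ^ 2)).sub se2.hasSum).add
    (se1.hasSum.mul_left z)).add (sf1.hasSum.mul_left ((1 - 2 * x ^ 2) * z))).add
    (se.hasSum.mul_left (z ^ 2))).add (sf.hasSum.mul_left (z ^ 2))
  have H' := H.tsum_eq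
  have H2 : ∑' n : ℕ, hsq x (n + 3) * (((n + 3 : ℕ) : ℝ) * z ^ (n + 3 - 1)) = _ :=
    Eq.trans (tsum_congr fun n => by
      have := hsq_rec x n
      rw [show n + 3 - 1 = n + 2 from rfl]
      push_cast
      simp only [pow_add]
      linear_combination z ^ n * z ^ 2 * this) H'
  rw [H2] at d3
  rw [hE] at d3 e1 e2
  change _ = genD x z at d3
  change _ = genF x z at f1
  change _ = genF x z at f2
  change _ + (_ + z ^ 2 * genF x z) = _ at d3
  generalize (∑' (i : ℕ), hsq x (i + 1) * z ^ (i + 1)) = F1 at *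
  generalize (∑' (i : ℕ), hsq x (i + 2) * z ^ (i + 2)) = F2 at *
  generalize (∑' (i : ℕ), ((i + 1 : ℕ) : ℝ) * hsq x (i + 1) * z ^ (i + 1)) = E1 at *
  generalize (∑' (i : ℕ), ((i + 2 : ℕ) : ℝ) * hsq x (i + 2) * z ^ (i + 2)) = E2 at *
  simp [Finset.sum_range_succ, hsq_zero, hsq_one, hsq_two] at f1 f2 e1 e2 d3
  linear_combination -d3 + 2 * x ^ 2 * f2 - e2 + z * e1 + (1 - 2 * x ^ 2) * z * f1

theorem mehler_kernel (z : ℝ) (hz : z ∈ Set.Ico (0 : ℝ) 1) (x : ℝ) :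
    ∑' k : ℕ, z ^ k * (hermiteFun k x) ^ 2 =
      (1 / Real.sqrt (π * (1 - z ^ 2))) * Real.exp (-x ^ 2 * (1 - z) / (1 + z)) := by
  obtain ⟨hz0, hz1⟩ := hz
  have hK : ∀ t ∈ Set.Ioo (-1 : ℝ) 1, HasDerivAt
      (fun t => genF x t * (√(1 - t ^ 2) * Real.exp (-(2 * x ^ 2 * t) / (1 + t)))) 0 t := by
    intro t ht
    have ht' : |t| < 1 := abs_lt.2 ht
    have p1 : 0 < 1 + t := by linarith [ht.1]
    have p2 : 0 < 1 - t ^ 2 := by nlinarith [ht.1, ht.2]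
    have h1 := genF_deriv x t ht'
    have h2 : HasDerivAt (fun t : ℝ => √(1 - t ^ 2)) (-(2 * t) / (2 * √(1 - t ^ 2))) t := by
      have := ((hasDerivAt_pow 2 t).const_sub 1).sqrt p2.ne'
      simpa using this
    have h3 : HasDerivAt (fun t : ℝ => -(2 * x ^ 2 * t) / (1 + t))
        ((-(2 * x ^ 2 * 1) * (1 + t) - -(2 * x ^ 2 * t) * 1) / (1 + t) ^ 2) t :=
      (((hasDerivAt_id t).const_mul (2 * x ^ 2)).neg).div ((hasDerivAt_id t).const_add 1) p1.ne'
    have h4 := h1.mul (h2.mul h3.exp)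
    refine h4.congr_deriv ?_
    have ode := gen_ode x t ht'
    have hs : √(1 - t ^ 2) ^ 2 = 1 - t ^ 2 := Real.sq_sqrt p2.le
    have hs0 : 0 < √(1 - t ^ 2) := Real.sqrt_pos.2 p2
    simp only [Pi.mul_apply]
    generalize Real.exp (-(2 * x ^ 2 * t) / (1 + t)) = e
    generalize √(1 - t ^ 2) = s at *
    have hD : genD x t = (t * (1 + t) + 2 * x ^ 2 * (1 - t)) * genF x t / (s ^ 2 * (1 + t)) := by
      rw [eq_div_iff (by positivity), hs]; linarith
    have ht2 : t ^ 2 = 1 - s ^ 2 := by linarith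
    rw [hD]
    field_simp
    linear_combination (-2 * x ^ 2 * e * genF x t) * hs
  have hconst : genF x z * (√(1 - z ^ 2) * Real.exp (-(2 * x ^ 2 * z) / (1 + z))) = 1 := by
    have := isOpen_Ioo.is_const_of_deriv_eq_zero (isPreconnected_Ioo (a := (-1 : ℝ)) (b := 1))
      (fun t ht => (hK t ht).differentiableAt.differentiableWithinAt)
      (fun t ht => (hK t ht).deriv) (x := z) (y := 0) ⟨by linarith, hz1⟩ (by norm_num)
    rw [this]
    have h0 : genF x 0 = 1 := by
      rw [genF, tsum_eq_single 0 (fun n hn => by simp [hn])]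
      simp [hsq_zero]
    simp [h0]
  have p1 : 0 < 1 + z := by linarith
  have p2 : 0 < 1 - z ^ 2 := by nlinarith
  have hs : 0 < √(1 - z ^ 2) := Real.sqrt_pos.2 p2
  have hp : 0 < √π := Real.sqrt_pos.2 Real.pi_pos
  have hF : ∑' k : ℕ, z ^ k * (hermiteFun k x) ^ 2 = (√π)⁻¹ * Real.exp (-x ^ 2) * genF x z := by
    rw [genF, ← tsum_mul_left]
    congr 1; funext k
    have h1 : Real.exp (-x ^ 2) = Real.exp (-x ^ 2 / 2) ^ 2 := by
      rw [← Real.exp_nat_mul]; congr 1; push_cast; ring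
    unfold hermiteFun hsq
    rw [mul_pow, mul_pow, inv_pow, Real.sq_sqrt (by positivity), h1]
    field_simp
  rw [hF, Real.sqrt_mul Real.pi_pos.le]
  have he : Real.exp (-x ^ 2) = Real.exp (-x ^ 2 * (1 - z) / (1 + z)) *
      Real.exp (-(2 * x ^ 2 * z) / (1 + z)) := by
    rw [← Real.exp_add]; congr 1; field_simp; ring
  rw [he]
  generalize Real.exp (-(2 * x ^ 2 * z) / (1 + z)) = e at *
  field_simp
  linear_combination hconst
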